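/- Let k ≥ 2. For every sequence (i₁,…,i_{2k−2}) ∈ {1,2}^{2k−2}, let w = a_{1,i₁} a_{i₁,i₂} ⋯ a_{i_{2k−3},i_{2k−2}} and T_{k,i₁,…,i_{2k−2}} = w⁻¹ T_k w. Then T_{k,i₁,…,i_{2k−2}} is a positive braid with T_{k,i₁,…,i_{2k−2}} ≼ Δ^{4k−1}; in particular its canonical length is 4k−1 and it belongs to the super summit set of T_k. -/

import Mathlib

/-- Defining relations of the braid group on 5 strands, as elements of the
free group on four generators (generator `i` corresponds to `σ_{i+1}`). -/
def braidRels : Set (FreeGroup (Fin 4)) :=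
  { r | (∃ i : Fin 3, r = FreeGroup.of i.castSucc * FreeGroup.of i.succ * FreeGroup.of i.castSucc *
          (FreeGroup.of i.succ * FreeGroup.of i.castSucc * FreeGroup.of i.succ)⁻¹) ∨
        (∃ i j : Fin 4, 2 ≤ |(i : ℤ) - (j : ℤ)| ∧
          r = FreeGroup.of i * FreeGroup.of j * (FreeGroup.of j * FreeGroup.of i)⁻¹) }

/-- The Artin braid group on 5 strands. -/
abbrev B5 : Type := PresentedGroup braidRels

/-- The Artin generators (index `i` corresponds to `σ_{i+1}`). -/
def gen (i : Fin 4) : B5 := PresentedGroup.of i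

def s1 : B5 := gen 0
def s2 : B5 := gen 1
def s3 : B5 := gen 2
def s4 : B5 := gen 3

/-- A braid is positive if it lies in the submonoid generated by `σ₁,…,σ₄`. -/
def IsPos (x : B5) : Prop := x ∈ Submonoid.closure (Set.range gen)

/-- Prefix order: `Pre x y` means `x ≼ y`, i.e. `x⁻¹ y` is positive. -/
def Pre (x y : B5) : Prop := IsPos (x⁻¹ * y)

/-- The half twist `Δ = σ₁σ₂σ₃σ₄σ₁σ₂σ₃σ₁σ₂σ₁`. -/
def Δ : B5 := s1*s2*s3*s4*s1*s2*s3*s1*s2*s1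

def δ3 : B5 := s2*s1
def Δ3 : B5 := s2*s1*s2
def δt3 : B5 := s1*s2

/-- A braid `s` is simple if `1 ≼ s ≼ Δ`. -/
def IsSimple (s : B5) : Prop := IsPos s ∧ Pre s Δ

/-- Two simple braids `s, t` are left-weighted if no generator `σᵢ` is such that
`s σᵢ` and `σᵢ⁻¹ t` are both simple. -/
def LeftWeighted (s t : B5) : Prop :=
  ¬ ∃ i : Fin 4, IsSimple (s * gen i) ∧ IsSimple ((gen i)⁻¹ * t)

/-- The canonical length of `z`: the minimum of `q - p` over `p ≤ q` with
`Δ^p ≼ z` and `z ≼ Δ^q`. -/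
noncomputable def canLen (z : B5) : ℕ :=
  sInf { n : ℕ | ∃ p q : ℤ, p ≤ q ∧ q - p = (n : ℤ) ∧ Pre (Δ ^ p) z ∧ Pre z (Δ ^ q) }

/-- `y` belongs to the super summit set of `x`:
`y` is conjugate to `x` and has minimal canonical length among conjugates of `x`. -/
def InSSS (x y : B5) : Prop :=
  IsConj x y ∧ ∀ z : B5, IsConj x z → canLen y ≤ canLen z

/-- The braid `T_k = δ₃^{3k+1} σ₄^{2k+2} σ₃ σ₄^{2k-1}`. -/
def T (k : ℕ) : B5 := δ3 ^ (3*k+1) * s4 ^ (2*k+2) * s3 * s4 ^ (2*k-1)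

/-- The braid `T'_k`, a rigid conjugate of `T_k`. -/
def T' (k : ℕ) : B5 :=
  (s1*s3)^(2*k-2) * (s3*s4*Δ3) * (Δ3*s4) * ((δ3*s4)*(δt3*s4))^(k-1) * (δ3*s4*s3*s4)

/-- The four simple 3-braids `a_{1,1}=σ₁`, `a_{1,2}=σ₁σ₂`, `a_{2,1}=σ₂σ₁`, `a_{2,2}=σ₂`
(index `0` stands for `1` and index `1` stands for `2`). -/
def aGen : Fin 2 → Fin 2 → B5
  | 0, 0 => s1
  | 0, 1 => s1*s2
  | 1, 0 => s2*s1
  | 1, 1 => s2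

/-- The `n`-th letter `a_{i_n, i_{n+1}}` of the conjugating word, with the convention
`i₀ = 1` (encoded as `0 : Fin 2`); the sequence `i` is 0-indexed, so `i t` encodes
`i_{t+1}` of the paper. -/
def letter (i : ℕ → Fin 2) (n : ℕ) : B5 :=
  aGen (if n = 0 then 0 else i (n-1)) (i n)

/-- The word `a_{1,i₁} a_{i₁,i₂} ⋯` built from the first `n` letters. -/
def seqWord (i : ℕ → Fin 2) : ℕ → B5
  | 0 => 1
  | n+1 => seqWord i n * letter i n

/-- The conjugate `T_{k,i₁,…,i_{2k-2}} = w⁻¹ T_k w` where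
`w = a_{1,i₁} a_{i₁,i₂} ⋯ a_{i_{2k-3},i_{2k-2}}`. -/
def Tki (k : ℕ) (i : ℕ → Fin 2) : B5 :=
  (seqWord i (2*k-2))⁻¹ * T k * seqWord i (2*k-2)

/-- The word in the Artin generators spelled by a list of indices. -/
def braidWord (l : List (Fin 4)) : B5 := (l.map gen).prod

/-- The words `r, s` of length at most two with `σₐ⁻¹ σ_b = r s⁻¹`. -/
def exchange (a b : Fin 4) : List (Fin 4) × List (Fin 4) :=
  if a = b then ([], [])
  else if a.val + 1 = b.val ∨ b.val + 1 = a.val then ([b, a], [a, b])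
  else ([b], [a])

/-- Word reversing: if `reversing n u v = some (v', u')`, then `u⁻¹ v = v' u'⁻¹` as braids.
The first argument bounds the recursion depth. -/
def reversing : ℕ → List (Fin 4) → List (Fin 4) → Option (List (Fin 4) × List (Fin 4))
  | 0, _, _ => none
  | _ + 1, [], v => some (v, [])
  | _ + 1, u, [] => some ([], u)
  | n + 1, a :: u, b :: v =>
    (reversing n u (exchange a b).1).bind fun x =>
      (reversing n (exchange a b).2 v).bind fun y =>
        (reversing n x.2 y.1).bind fun z => some (x.1 ++ z.1, y.2 ++ z.2)

/-- Word reversing turns `u⁻¹ v` into a positive word. -/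
def reversesToPos (u v : List (Fin 4)) : Bool :=
  match reversing 200 u v with
  | some (_, []) => true
  | _ => false

/-- Word reversing turns `u⁻¹ v` into the empty word. -/
def reversesToOne (u v : List (Fin 4)) : Bool :=
  match reversing 200 u v with
  | some ([], []) => true
  | _ => false

/-- The letter `a_{x,y}` as a list of indices. -/
def aWord : Fin 2 → Fin 2 → List (Fin 4)
  | 0, 0 => [0]
  | 0, 1 => [0, 1]
  | 1, 0 => [1, 0]
  | 1, 1 => [1]

/-- The half twist as a list of indices. -/
def ΔWord : List (Fin 4) := [0, 1, 2, 3, 0, 1, 2, 0, 1, 0]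

/-- The braid `T₂` as a list of indices. -/
def T2Word : List (Fin 4) :=
  [1, 0, 1, 0, 1, 0, 1, 0, 1, 0, 1, 0, 1, 0, 3, 3, 3, 3, 3, 3, 2, 3, 3, 3]

theorem gen_mul_gen_mul_gen (i : Fin 3) :
    gen i.castSucc * gen i.succ * gen i.castSucc = gen i.succ * gen i.castSucc * gen i.succ := by
  have h := PresentedGroup.one_of_mem (rels := braidRels) (Or.inl ⟨i, rfl⟩)
  rw [map_mul, map_inv, mul_inv_eq_one] at h
  simp only [map_mul] at h
  exact h

theorem gen_mul_gen_comm (i j : Fin 4) (hij : 2 ≤ |(i : ℤ) - (j : ℤ)|) :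
    gen i * gen j = gen j * gen i := by
  have h := PresentedGroup.one_of_mem (rels := braidRels) (Or.inr ⟨i, j, hij, rfl⟩)
  rw [map_mul, map_inv, mul_inv_eq_one] at h
  simp only [map_mul] at h
  exact h

@[simp] theorem braidWord_nil : braidWord [] = 1 := rfl

@[simp] theorem braidWord_cons (a : Fin 4) (l : List (Fin 4)) :
    braidWord (a :: l) = gen a * braidWord l := by simp [braidWord]

@[simp] theorem braidWord_append (l m : List (Fin 4)) :
    braidWord (l ++ m) = braidWord l * braidWord m := by simp [braidWord]

theorem gen_mul_exchange (a b : Fin 4) :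
    gen a * braidWord (exchange a b).1 = gen b * braidWord (exchange a b).2 := by
  have h01 := gen_mul_gen_mul_gen 0
  have h12 := gen_mul_gen_mul_gen 1
  have h23 := gen_mul_gen_mul_gen 2
  have h02 := gen_mul_gen_comm 0 2 (by decide)
  have h03 := gen_mul_gen_comm 0 3 (by decide)
  have h13 := gen_mul_gen_comm 1 3 (by decide)
  fin_cases a <;> fin_cases b <;> simp_all [exchange, mul_assoc]

theorem reversing_sound (n : ℕ) (u v u' v' : List (Fin 4)) (h : reversing n u v = some (v', u')) :
    braidWord v * braidWord u' = braidWord u * braidWord v' := by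
  induction n generalizing u v u' v' with
  | zero => simp [reversing] at h
  | succ n ih =>
    match u, v with
    | [], v => simp only [reversing, Option.some.injEq, Prod.mk.injEq] at h; simp [← h.1, ← h.2]
    | a :: u, [] =>
      simp only [reversing, Option.some.injEq, Prod.mk.injEq] at h; simp [← h.1, ← h.2]
    | a :: u, b :: v =>
      simp only [reversing, Option.bind_eq_some_iff, Option.some.injEq, Prod.mk.injEq] at h
      obtain ⟨⟨p, u₂⟩, h₁, ⟨v₂, s₂⟩, h₂, ⟨v₃, u₃⟩, h₃, rfl, rfl⟩ := h
      have e₀ := gen_mul_exchange a b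
      have e₁ := ih _ _ _ _ h₁
      have e₂ := ih _ _ _ _ h₂
      have e₃ := ih _ _ _ _ h₃
      simp only [braidWord_cons, braidWord_append]
      calc gen b * braidWord v * (braidWord s₂ * braidWord u₃)
          = gen b * (braidWord v * braidWord s₂) * braidWord u₃ := by simp only [mul_assoc]
        _ = (gen b * braidWord (exchange a b).2) * (braidWord v₂ * braidWord u₃) := by
            rw [e₂]; simp only [mul_assoc]
        _ = gen a * (braidWord (exchange a b).1 * braidWord u₂) * braidWord v₃ := by
            rw [← e₀, e₃]; simp only [mul_assoc]
        _ = gen a * braidWord u * (braidWord p * braidWord v₃) := by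
            rw [e₁]; simp only [mul_assoc]

theorem IsPos.mul {x y : B5} (hx : IsPos x) (hy : IsPos y) : IsPos (x * y) :=
  Submonoid.mul_mem _ hx hy

theorem isPos_one : IsPos 1 := Submonoid.one_mem _

theorem isPos_gen (a : Fin 4) : IsPos (gen a) := Submonoid.subset_closure ⟨a, rfl⟩

theorem IsPos.pow {x : B5} (hx : IsPos x) (n : ℕ) : IsPos (x ^ n) := Submonoid.pow_mem _ hx n

theorem isPos_braidWord (l : List (Fin 4)) : IsPos (braidWord l) := by
  induction l with
  | nil => exact isPos_one
  | cons a l ih => rw [braidWord_cons]; exact (isPos_gen a).mul ih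

theorem isPos_of_reversesToPos {u v : List (Fin 4)} (h : reversesToPos u v = true) :
    IsPos ((braidWord u)⁻¹ * braidWord v) := by
  unfold reversesToPos at h
  split at h
  · next v' hv =>
    have := reversing_sound _ _ _ _ _ hv
    rw [braidWord_nil, mul_one] at this
    rw [this, inv_mul_cancel_left]
    exact isPos_braidWord _
  · simp at h

theorem braidWord_eq_of_reversesToOne {u v : List (Fin 4)} (h : reversesToOne u v = true) :
    braidWord u = braidWord v := by
  unfold reversesToOne at h
  split at h
  · next hv => simpa using (reversing_sound _ _ _ _ _ hv).symm
  · simp at h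

theorem braidWord_ΔWord : braidWord ΔWord = Δ := by
  simp [ΔWord, Δ, s1, s2, s3, s4, mul_assoc]

theorem braidWord_aWord (x y : Fin 2) : braidWord (aWord x y) = aGen x y := by
  fin_cases x <;> fin_cases y <;> simp [aWord, aGen, s1, s2]

theorem braidWord_T2Word : braidWord T2Word = T 2 := by
  simp [T2Word, T, δ3, s1, s2, s3, s4, mul_assoc, pow_succ]

theorem closure_range_gen : Subgroup.closure (Set.range gen) = ⊤ :=
  PresentedGroup.closure_range_of braidRels

/-- The square of the half twist is central. -/
theorem commute_Δ_sq (x : B5) : Commute (Δ ^ 2) x := by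
  have h : Set.range gen ⊆ (Subgroup.centralizer {Δ ^ 2} : Set B5) := by
    rintro _ ⟨a, rfl⟩
    have h : ∀ a, reversesToOne (ΔWord ++ ΔWord ++ [a]) (a :: (ΔWord ++ ΔWord)) = true := by
      decide +kernel
    have := braidWord_eq_of_reversesToOne (h a)
    simp only [braidWord_append, braidWord_cons, braidWord_ΔWord, braidWord_nil, mul_one] at this
    rw [SetLike.mem_coe, Subgroup.mem_centralizer_singleton_iff, pow_two]
    exact this.symm
  have hx : x ∈ Subgroup.centralizer {Δ ^ 2} :=
    (Subgroup.closure_le _).2 h (closure_range_gen ▸ Subgroup.mem_top x)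
  exact (Subgroup.mem_centralizer_singleton_iff.1 hx).symm

/-- Every braid becomes positive after multiplication by a power of `Δ²`. -/
theorem exists_isPos_Δ_pow_mul (x : B5) : ∃ m : ℕ, IsPos ((Δ ^ 2) ^ m * x) := by
  have hx : x ∈ Submonoid.closure (Set.range gen ∪ (Set.range gen)⁻¹) := by
    rw [← Subgroup.closure_toSubmonoid, closure_range_gen]; trivial
  induction hx using Submonoid.closure_induction with
  | one => exact ⟨0, by simpa using isPos_one⟩
  | mem x hx =>
    rcases hx with ⟨a, rfl⟩ | ⟨a, ha⟩
    · exact ⟨0, by simpa using isPos_gen a⟩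
    · refine ⟨1, ?_⟩
      obtain rfl : x = (gen a)⁻¹ := by rw [ha, inv_inv]
      have h : ∀ a, reversesToPos [a] (ΔWord ++ ΔWord) = true := by decide +kernel
      rw [pow_one, (commute_Δ_sq _).eq]
      simpa [braidWord_ΔWord, pow_two] using isPos_of_reversesToPos (h a)
  | mul x y _ _ hx hy =>
    obtain ⟨m, hm⟩ := hx
    obtain ⟨n, hn⟩ := hy
    refine ⟨m + n, ?_⟩
    have h : (Δ ^ 2) ^ (m + n) * (x * y) = (Δ ^ 2) ^ m * x * ((Δ ^ 2) ^ n * y) := by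
      rw [pow_add, mul_assoc, mul_assoc, ← mul_assoc _ x, ((commute_Δ_sq x).pow_left n).eq,
        mul_assoc]
    exact h ▸ hm.mul hn

theorem commute_s4_aGen (x y : Fin 2) : Commute s4 (aGen x y) := by
  have h : ∀ x y, reversesToOne (3 :: aWord x y) (aWord x y ++ [3]) = true := by decide +kernel
  simpa [braidWord_aWord, s4, Commute, SemiconjBy] using braidWord_eq_of_reversesToOne (h x y)

theorem commute_δ3_cube_aGen (x y : Fin 2) : Commute (δ3 ^ 3) (aGen x y) := by
  have h : ∀ x y, reversesToOne ([1, 0, 1, 0, 1, 0] ++ aWord x y)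
      (aWord x y ++ [1, 0, 1, 0, 1, 0]) = true := by decide +kernel
  simpa [braidWord_aWord, δ3, s1, s2, pow_succ, mul_assoc, Commute, SemiconjBy]
    using braidWord_eq_of_reversesToOne (h x y)

theorem Commute.seqWord_right {x : B5} (h : ∀ a b, Commute x (aGen a b)) (i : ℕ → Fin 2) (n : ℕ) :
    Commute x (seqWord i n) := by
  induction n with
  | zero => exact Commute.one_right x
  | succ n ih => exact ih.mul_right (h _ _)

theorem commute_s4_δ3 : Commute s4 δ3 := by
  simpa [aGen, δ3] using commute_s4_aGen 1 0

/-- The two letters added to the conjugating word when passing from `k` to `k + 1`. -/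
def letterPair (x y z : Fin 2) : B5 := aGen x y * aGen y z

theorem T_succ (j : ℕ) : T (j + 2) = δ3 ^ 3 * s4 ^ 2 * T (j + 1) * s4 ^ 2 := by
  have h := (commute_s4_δ3.pow_pow 2 (3 * (j + 1) + 1)).eq
  have e₁ : 3 * (j + 2) + 1 = 3 + (3 * (j + 1) + 1) := by ring
  have e₂ : 2 * (j + 2) + 2 = 2 + (2 * (j + 1) + 2) := by ring
  have e₃ : 2 * (j + 2) - 1 = 2 * (j + 1) - 1 + 2 := by omega
  unfold T
  rw [e₁, e₂, e₃, pow_add δ3 3, pow_add s4 2 (2 * (j + 1) + 2), pow_add s4 (2 * (j + 1) - 1) 2]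
  simp only [mul_assoc]
  rw [← mul_assoc (s4 ^ 2) (δ3 ^ (3 * (j + 1) + 1)), h]
  simp only [mul_assoc]

theorem Tki_succ (i : ℕ → Fin 2) (j : ℕ) (x y z : Fin 2)
    (hx : letter i (2 * j) = aGen x y) (hy : letter i (2 * j + 1) = aGen y z) :
    Tki (j + 2) i =
      (letterPair x y z)⁻¹ * (δ3 ^ 3 * s4 ^ 2) * Tki (j + 1) i * (s4 ^ 2 * letterPair x y z) := by
  have hw : seqWord i (2 * (j + 2) - 2) = seqWord i (2 * j) * letterPair x y z := by
    rw [show 2 * (j + 2) - 2 = 2 * j + 1 + 1 by omega]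
    simp only [seqWord, hx, hy, letterPair, mul_assoc]
  have h₄ : Commute (s4 ^ 2) (seqWord i (2 * j)) :=
    (Commute.seqWord_right commute_s4_aGen i _).pow_left 2
  have h₃ : Commute (δ3 ^ 3 * s4 ^ 2) (seqWord i (2 * j)) :=
    (Commute.seqWord_right commute_δ3_cube_aGen i _).mul_left h₄
  have e : 2 * (j + 1) - 2 = 2 * j := by omega
  unfold Tki
  rw [hw, e, T_succ, mul_inv_rev]
  set v := seqWord i (2 * j)
  set a := letterPair x y z
  set c := δ3 ^ 3 * s4 ^ 2
  calc a⁻¹ * v⁻¹ * (c * T (j + 1) * s4 ^ 2) * (v * a)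
      = a⁻¹ * (v⁻¹ * c) * T (j + 1) * (s4 ^ 2 * v) * a := by simp only [mul_assoc]
    _ = a⁻¹ * (c * v⁻¹) * T (j + 1) * (v * s4 ^ 2) * a := by
        rw [h₃.symm.inv_left.eq, h₄.eq]
    _ = _ := by simp only [mul_assoc]

theorem inv_mul_Δ_pow_eq (a t b : B5) (j : ℕ) :
    (a * t * b)⁻¹ * Δ ^ (4 * j + 7) =
      (b⁻¹ * Δ ^ 2) * (t⁻¹ * Δ ^ (4 * j + 3)) * ((a * Δ)⁻¹ * Δ ^ 3) := by
  have e₁ : Δ ^ (4 * j + 7) = (Δ ^ 2) ^ (2 * j + 2) * Δ ^ 3 := by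
    rw [← pow_mul, ← pow_add]; ring_nf
  have e₂ : Δ ^ (4 * j + 3) = (Δ ^ 2) ^ (2 * j + 1) * Δ := by
    rw [← pow_mul, ← pow_succ]; ring_nf
  have h₁ := ((commute_Δ_sq a⁻¹).pow_left (2 * j + 2)).eq
  have h₂ := (commute_Δ_sq t⁻¹).eq
  rw [e₁, e₂]
  calc (a * t * b)⁻¹ * ((Δ ^ 2) ^ (2 * j + 2) * Δ ^ 3)
      = b⁻¹ * t⁻¹ * (a⁻¹ * (Δ ^ 2) ^ (2 * j + 2)) * Δ ^ 3 := by
        simp only [mul_inv_rev, mul_assoc]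
    _ = b⁻¹ * (t⁻¹ * Δ ^ 2) * ((Δ ^ 2) ^ (2 * j + 1) * a⁻¹) * Δ ^ 3 := by
        rw [← h₁, pow_succ' (Δ ^ 2)]; simp only [mul_assoc]
    _ = b⁻¹ * (Δ ^ 2 * t⁻¹) * ((Δ ^ 2) ^ (2 * j + 1) * a⁻¹) * Δ ^ 3 := by rw [h₂]
    _ = _ := by simp only [mul_inv_rev, mul_assoc, mul_inv_cancel_left]

/-- The complement of `Tki k i` in `Δ ^ (4k - 1)`. -/
def Qki (k : ℕ) (i : ℕ → Fin 2) : B5 := (Tki k i)⁻¹ * Δ ^ (4 * k - 1)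

theorem Qki_succ (i : ℕ → Fin 2) (j : ℕ) (x y z : Fin 2)
    (hx : letter i (2 * j) = aGen x y) (hy : letter i (2 * j + 1) = aGen y z) :
    Qki (j + 2) i = ((s4 ^ 2 * letterPair x y z)⁻¹ * Δ ^ 2) * Qki (j + 1) i *
      ((δ3 ^ 3 * s4 ^ 2 * Δ)⁻¹ * (letterPair x y z * Δ ^ 3)) := by
  unfold Qki
  rw [Tki_succ i j x y z hx hy, show 4 * (j + 2) - 1 = 4 * j + 7 by omega,
    show 4 * (j + 1) - 1 = 4 * j + 3 by omega, inv_mul_Δ_pow_eq]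
  congr 1
  simp only [mul_inv_rev, inv_inv, mul_assoc]

theorem letter_succ (i : ℕ → Fin 2) (n : ℕ) : letter i (n + 1) = aGen (i n) (i (n + 1)) := rfl

theorem letter_zero (i : ℕ → Fin 2) : letter i 0 = aGen 0 (i 0) := rfl

theorem Tki_two (i : ℕ → Fin 2) :
    Tki 2 i = (letterPair 0 (i 0) (i 1))⁻¹ * T 2 * letterPair 0 (i 0) (i 1) := by
  simp [Tki, seqWord, letter_zero, letter_succ, letterPair]

theorem isPos_Tki_two (i : ℕ → Fin 2) : IsPos (Tki 2 i) := by
  have h : ∀ x y, reversesToPos (aWord 0 x ++ aWord x y)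
      (T2Word ++ aWord 0 x ++ aWord x y) = true := by
    decide +kernel
  simpa [Tki_two, letterPair, braidWord_aWord, braidWord_T2Word, mul_assoc]
    using isPos_of_reversesToPos (h (i 0) (i 1))

theorem isPos_Qki_two (i : ℕ → Fin 2) : IsPos (Qki 2 i) := by
  have h : ∀ x y, reversesToPos (T2Word ++ aWord 0 x ++ aWord x y)
      (aWord 0 x ++ aWord x y ++ (List.replicate 7 ΔWord).flatten) = true := by
    decide +kernel
  have := isPos_of_reversesToPos (h (i 0) (i 1))
  simpa [Qki, Tki_two, letterPair, braidWord_aWord, braidWord_T2Word, braidWord_ΔWord, mul_assoc,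
    pow_succ, List.replicate] using this

theorem isPos_letterPair_inv_mul (x y z : Fin 2) :
    IsPos ((letterPair x y z)⁻¹ * (δ3 ^ 3 * s4 ^ 2)) := by
  have h : ∀ x y z, reversesToPos (aWord x y ++ aWord y z) [1, 0, 1, 0, 1, 0, 3, 3] = true := by
    decide +kernel
  simpa [letterPair, braidWord_aWord, δ3, s1, s2, s4, pow_succ, mul_assoc]
    using isPos_of_reversesToPos (h x y z)

theorem isPos_s4_sq_mul_letterPair (x y z : Fin 2) : IsPos (s4 ^ 2 * letterPair x y z) := by
  have h := isPos_braidWord ([3, 3] ++ aWord x y ++ aWord y z)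
  simpa [letterPair, braidWord_aWord, s4, pow_succ, mul_assoc] using h

theorem isPos_letterPair_compl_right (x y z : Fin 2) :
    IsPos ((s4 ^ 2 * letterPair x y z)⁻¹ * Δ ^ 2) := by
  have h : ∀ x y z, reversesToPos ([3, 3] ++ aWord x y ++ aWord y z) (ΔWord ++ ΔWord) = true := by
    decide +kernel
  simpa [letterPair, braidWord_aWord, braidWord_ΔWord, s4, pow_succ, mul_assoc]
    using isPos_of_reversesToPos (h x y z)

theorem isPos_letterPair_compl_left (x y z : Fin 2) :
    IsPos ((δ3 ^ 3 * s4 ^ 2 * Δ)⁻¹ * (letterPair x y z * Δ ^ 3)) := by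
  have h : ∀ x y z, reversesToPos ([1, 0, 1, 0, 1, 0, 3, 3] ++ ΔWord)
      (aWord x y ++ aWord y z ++ ΔWord ++ ΔWord ++ ΔWord) = true := by
    decide +kernel
  simpa [letterPair, braidWord_aWord, braidWord_ΔWord, δ3, s1, s2, s4, pow_succ, mul_assoc]
    using isPos_of_reversesToPos (h x y z)

theorem isPos_Tki_and_Qki (k : ℕ) (hk : 2 ≤ k) (i : ℕ → Fin 2) :
    IsPos (Tki k i) ∧ IsPos (Qki k i) := by
  induction k, hk using Nat.le_induction with
  | base => exact ⟨isPos_Tki_two i, isPos_Qki_two i⟩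
  | succ k hk ih =>
    obtain ⟨j, rfl⟩ : ∃ j, k = j + 2 := ⟨k - 2, by omega⟩
    have hx : letter i (2 * (j + 1)) = aGen (i (2 * j + 1)) (i (2 * j + 2)) := letter_succ i _
    have hy : letter i (2 * (j + 1) + 1) = aGen (i (2 * j + 2)) (i (2 * j + 3)) := letter_succ i _
    rw [Tki_succ i (j + 1) _ _ _ hx hy, Qki_succ i (j + 1) _ _ _ hx hy]
    exact ⟨((isPos_letterPair_inv_mul _ _ _).mul ih.1).mul (isPos_s4_sq_mul_letterPair _ _ _),
      ((isPos_letterPair_compl_right _ _ _).mul ih.2).mul (isPos_letterPair_compl_left _ _ _)⟩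

/-- The nonzero entries, row by row, of the Lawrence–Krammer matrices of the Artin generators at
the parameters `t = 24`, `q = 2`. -/
def lkRows : Fin 4 → List (List (ℕ × ℤ))
  | 0 => [
      [(0, 96), (1, 48), (2, 48), (3, 48)], [(4, 1)], [(5, 1)], [(6, 1)], [(1, 2), (4, -1)],
      [(2, 2), (5, -1)], [(3, 2), (6, -1)], [(7, 1)], [(8, 1)], [(9, 1)]]
  | 1 => [
      [(0, -1), (1, 1)], [(0, 2)], [(2, 1)], [(3, 1)],
      [(1, 96), (2, 48), (3, 48), (4, 96), (5, 48), (6, 48)], [(7, 1)], [(8, 1)],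
      [(5, 2), (7, -1)], [(6, 2), (8, -1)], [(9, 1)]]
  | 2 => [
      [(0, 1)], [(1, -1), (2, 1)], [(1, 2)], [(3, 1)], [(4, -1), (5, 1)], [(4, 2)], [(6, 1)],
      [(2, 192), (3, 96), (5, 96), (6, 48), (7, 96), (8, 48)], [(9, 1)], [(8, 2), (9, -1)]]
  | 3 => [
      [(0, 1)], [(1, 1)], [(2, -1), (3, 1)], [(2, 2)], [(4, 1)], [(5, -1), (6, 1)], [(5, 2)],
      [(7, -1), (8, 1)], [(7, 2)], [(3, 384), (6, 192), (8, 96), (9, 96)]]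

/-- The Lawrence–Krammer matrices of the Artin generators at the parameters `t = 24`, `q = 2`. -/
def lk (a : Fin 4) : Matrix (Fin 10) (Fin 10) ℤ :=
  fun i j => (((lkRows a).getD i []).map fun e => if e.1 = (j : ℕ) then e.2 else 0).sum

/-- The product of the Lawrence–Krammer matrices along a word. -/
def lkWord (l : List (Fin 4)) : Matrix (Fin 10) (Fin 10) ℤ := (l.map lk).prod

/-- The linear combination of the rows in `L` with the given coefficients, modulo `n`. -/
def rowComb (n : ℤ) (L : List (List ℤ)) : List (ℕ × ℤ) → List ℤ
  | [] => List.replicate 10 0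
  | e :: r => List.zipWith (fun x y => (e.2 * x + y) % n) (L.getD e.1 []) (rowComb n L r)

/-- The rows of the Lawrence–Krammer matrix of a word, with entries reduced modulo `n`. -/
def lkTable (n : ℤ) : List (Fin 4) → List (List ℤ)
  | [] => (List.range 10).map fun i => (List.range 10).map fun j => if i = j then 1 else 0
  | a :: l => (lkRows a).map (rowComb n (lkTable n l))

/-- The entry of a list of rows at the given position. -/
def entry (L : List (List ℤ)) (i j : ℕ) : ℤ := (L.getD i []).getD j 0

theorem length_rowComb (n : ℤ) (L : List (List ℤ)) (r : List (ℕ × ℤ))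
    (hL : ∀ i < 10, (L.getD i []).length = 10) (hr : ∀ e ∈ r, e.1 < 10) :
    (rowComb n L r).length = 10 := by
  induction r with
  | nil => rfl
  | cons e r ih =>
    rw [rowComb, List.length_zipWith, hL _ (hr e (by simp)),
      ih fun e he => hr e (List.mem_cons_of_mem _ he), min_self]

theorem getD_rowComb_modEq (n : ℤ) (L : List (List ℤ)) (r : List (ℕ × ℤ))
    (hL : ∀ i < 10, (L.getD i []).length = 10) (hr : ∀ e ∈ r, e.1 < 10) (j : Fin 10) :
    (rowComb n L r).getD j 0 ≡ (r.map fun e => e.2 * entry L e.1 j).sum [ZMOD n] := by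
  induction r with
  | nil => fin_cases j <;> exact Int.ModEq.refl _
  | cons e r ih =>
    have hr' : ∀ e ∈ r, e.1 < 10 := fun e he => hr e (List.mem_cons_of_mem _ he)
    have h₁ : (j : ℕ) < (L.getD e.1 []).length := (hL _ (hr e (by simp))).symm ▸ j.2
    have h₂ : (j : ℕ) < (rowComb n L r).length := (length_rowComb n L r hL hr').symm ▸ j.2
    have h₃ := ih hr'
    rw [List.getD_eq_getElem _ _ h₂] at h₃
    have h₄ : (j : ℕ) < (rowComb n L (e :: r)).length :=
      (length_rowComb n L (e :: r) hL hr).symm ▸ j.2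
    rw [List.getD_eq_getElem _ _ h₄, List.map_cons, List.sum_cons, entry,
      List.getD_eq_getElem _ _ h₁]
    simp only [rowComb, List.getElem_zipWith]
    exact (Int.mod_modEq _ _).trans (h₃.add_left _)

theorem length_lkRows (a : Fin 4) : (lkRows a).length = 10 := by
  revert a; decide

theorem lt_of_mem_lkRows (a : Fin 4) : ∀ r ∈ lkRows a, ∀ e ∈ r, e.1 < 10 := by
  revert a; decide

theorem length_lkTable (n : ℤ) (l : List (Fin 4)) :
    ∀ i < 10, ((lkTable n l).getD i []).length = 10 := by
  induction l with
  | nil => intro i hi; interval_cases i <;> rfl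
  | cons a l ih =>
    intro i hi
    have h : i < (lkRows a).length := (length_lkRows a).symm ▸ hi
    rw [lkTable, List.getD_eq_getElem _ _ (by simpa using h), List.getElem_map]
    exact length_rowComb _ _ _ ih (lt_of_mem_lkRows a _ (List.getElem_mem h))

theorem lk_mul_apply (a : Fin 4) (B : Matrix (Fin 10) (Fin 10) ℤ) (C : ℕ → ℤ) (i j : Fin 10)
    (n : ℤ) (hC : ∀ k : Fin 10, B k j ≡ C k [ZMOD n]) :
    (lk a * B) i j ≡ (((lkRows a).getD i []).map fun e => e.2 * C e.1).sum [ZMOD n] := by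
  have h : (i : ℕ) < (lkRows a).length := (length_lkRows a).symm ▸ i.2
  have hr := lt_of_mem_lkRows a _ (List.getElem_mem h)
  rw [Matrix.mul_apply]
  unfold lk
  rw [List.getD_eq_getElem _ _ h]
  generalize (lkRows a)[(i : ℕ)] = r at hr
  induction r with
  | nil => simp
  | cons e r ih =>
    simp only [List.map_cons, List.sum_cons, add_mul, Finset.sum_add_distrib]
    refine Int.ModEq.add ?_ (ih fun e he => hr e (List.mem_cons_of_mem _ he))
    rw [Finset.sum_eq_single ⟨e.1, hr e (by simp)⟩]
    · simpa using (hC ⟨e.1, hr e (by simp)⟩).mul_left e.2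
    · intro k _ hk
      rw [if_neg, zero_mul]
      rintro h
      exact hk (Fin.ext h.symm)
    · simp

theorem lkWord_modEq_entry (n : ℤ) (l : List (Fin 4)) (i j : Fin 10) :
    lkWord l i j ≡ entry (lkTable n l) i j [ZMOD n] := by
  induction l generalizing i j with
  | nil =>
    have h : (1 : Matrix (Fin 10) (Fin 10) ℤ) i j = entry (lkTable n []) i j := by
      simp [entry, lkTable, Matrix.one_apply, Fin.ext_iff]
    exact h ▸ Int.ModEq.refl _
  | cons a l ih =>
    have h : (i : ℕ) < (lkRows a).length := (length_lkRows a).symm ▸ i.2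
    have hr := lt_of_mem_lkRows a _ (List.getElem_mem h)
    have e := lk_mul_apply a (lkWord l) (fun k => entry (lkTable n l) k j) i j n (ih · j)
    have e' := getD_rowComb_modEq n (lkTable n l) _ (length_lkTable n l) hr j
    have h' : (lkTable n (a :: l)).getD i [] = rowComb n (lkTable n l) (lkRows a)[(i : ℕ)] := by
      rw [lkTable, List.getD_eq_getElem _ _ (by simpa using h), List.getElem_map]
    rw [List.getD_eq_getElem _ _ h] at e
    rw [lkWord, List.map_cons, List.prod_cons, entry, h']
    exact e.trans e'.symm

theorem lkWord_append (l m : List (Fin 4)) : lkWord (l ++ m) = lkWord l * lkWord m := by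
  simp [lkWord]

theorem lkWord_modEq_of_lkTable_eq {n : ℤ} {l m : List (Fin 4)} (h : lkTable n l = lkTable n m)
    (i j : Fin 10) : lkWord l i j ≡ lkWord m i j [ZMOD n] :=
  (lkWord_modEq_entry n l i j).trans (h ▸ (lkWord_modEq_entry n m i j).symm)

theorem lkWord_apply (l : List (Fin 4)) (i j : Fin 10) :
    lkWord l i j = entry (lkTable 0 l) i j :=
  Int.modEq_zero_iff.1 (lkWord_modEq_entry 0 l i j)

theorem lkWord_eq_of_lkTable_eq {l m : List (Fin 4)} (h : lkTable 0 l = lkTable 0 m) :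
    lkWord l = lkWord m := by
  ext i j
  rw [lkWord_apply, lkWord_apply, h]

theorem lk_mul_quadratic (a : Fin 4) :
    lk a * (lk a * lk a - (95 : ℤ) • lk a - (98 : ℤ) • 1) = (-192 : ℤ) • 1 := by
  have h : ∀ a, ∀ i j : Fin 10, entry (lkTable 0 [a, a, a]) i j =
      95 * entry (lkTable 0 [a, a]) i j + 98 * entry (lkTable 0 [a]) i j -
        192 * entry (lkTable 0 []) i j := by
    decide +kernel
  ext i j
  have h := h a i j
  simp only [← lkWord_apply] at h
  simp only [lkWord, List.map_cons, List.map_nil, List.prod_cons, List.prod_nil, mul_one] at h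
  simp only [mul_sub, mul_smul_comm, mul_one, Matrix.sub_apply, Matrix.smul_apply, smul_eq_mul, h]
  ring

/-- The inclusion of integer matrices into rational matrices. -/
noncomputable def ratMat : Matrix (Fin 10) (Fin 10) ℤ →+* Matrix (Fin 10) (Fin 10) ℚ :=
  (Int.castRingHom ℚ).mapMatrix

theorem isUnit_ratMat_lk (a : Fin 4) : IsUnit (ratMat (lk a)) := by
  have h := congrArg ratMat (lk_mul_quadratic a)
  rw [map_mul, map_zsmul, map_one] at h
  refine IsUnit.of_mul_eq_one
    ((-1 / 192 : ℚ) • ratMat (lk a * lk a - (95 : ℤ) • lk a - (98 : ℤ) • 1)) ?_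
  rw [mul_smul_comm, h, ← Int.cast_smul_eq_zsmul ℚ, smul_smul]
  norm_num

theorem lift_lk_eq_one (r : FreeGroup (Fin 4)) (hr : r ∈ braidRels) :
    FreeGroup.lift (fun a => (isUnit_ratMat_lk a).unit) r = 1 := by
  rcases hr with ⟨i, rfl⟩ | ⟨i, j, hij, rfl⟩
  · have h : ∀ i : Fin 3, lkTable 0 [i.castSucc, i.succ, i.castSucc] =
        lkTable 0 [i.succ, i.castSucc, i.succ] := by decide +kernel
    have h := congrArg ratMat (lkWord_eq_of_lkTable_eq (h i))
    simp only [lkWord, List.map_cons, List.map_nil, List.prod_cons, List.prod_nil, mul_one,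
      map_mul] at h
    rw [map_mul, map_inv, mul_inv_eq_one]
    ext1
    simpa [mul_assoc] using h
  · have h : ∀ i j : Fin 4, 2 ≤ |(i : ℤ) - (j : ℤ)| → lkTable 0 [i, j] = lkTable 0 [j, i] := by
      decide +kernel
    have h := congrArg ratMat (lkWord_eq_of_lkTable_eq (h i j hij))
    simp only [lkWord, List.map_cons, List.map_nil, List.prod_cons, List.prod_nil, mul_one,
      map_mul] at h
    rw [map_mul, map_inv, mul_inv_eq_one]
    ext1
    simpa using h

/-- The Lawrence–Krammer representation of `B₅` at the parameters `t = 24`, `q = 2`. -/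
noncomputable def lkRep : B5 →* (Matrix (Fin 10) (Fin 10) ℚ)ˣ :=
  PresentedGroup.toGroup lift_lk_eq_one

theorem lkRep_gen (a : Fin 4) : (lkRep (gen a) : Matrix (Fin 10) (Fin 10) ℚ) = ratMat (lk a) := by
  rw [lkRep, gen, PresentedGroup.toGroup.of, IsUnit.unit_spec]

theorem lkRep_braidWord (l : List (Fin 4)) :
    (lkRep (braidWord l) : Matrix (Fin 10) (Fin 10) ℚ) = ratMat (lkWord l) := by
  induction l with
  | nil => simp [lkWord]
  | cons a l ih => simp [lkWord, lkRep_gen, ih]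

theorem IsPos.exists_braidWord {x : B5} (hx : IsPos x) : ∃ l, x = braidWord l := by
  induction hx using Submonoid.closure_induction with
  | one => exact ⟨[], rfl⟩
  | mem x hx =>
    obtain ⟨a, rfl⟩ := hx
    exact ⟨[a], by simp⟩
  | mul x y _ _ hx hy =>
    obtain ⟨l, rfl⟩ := hx
    obtain ⟨m, rfl⟩ := hy
    exact ⟨l ++ m, (braidWord_append l m).symm⟩

/-- The character of the Lawrence–Krammer representation. -/
noncomputable def lkChar (x : B5) : ℚ := (lkRep x : Matrix (Fin 10) (Fin 10) ℚ).trace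

theorem lkChar_eq_of_isConj {x y : B5} (h : IsConj x y) : lkChar x = lkChar y := by
  obtain ⟨c, rfl⟩ := isConj_iff.1 h
  rw [lkChar, lkChar, map_mul, map_mul, map_inv, Units.val_mul, Units.val_mul,
    Matrix.trace_units_conj]

theorem lkChar_braidWord (l : List (Fin 4)) : lkChar (braidWord l) = (lkWord l).trace := by
  rw [lkChar, lkRep_braidWord, ratMat]
  simp [Matrix.trace]

theorem dvd_lkWord_ΔWord (i j : Fin 10) : (24 : ℤ) ∣ lkWord ΔWord i j := by
  have h : ∀ i j : Fin 10, entry (lkTable 24 ΔWord) i j = 0 := by decide +kernel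
  exact Int.modEq_zero_iff_dvd.1 (h i j ▸ lkWord_modEq_entry 24 ΔWord i j)

theorem lkWord_ΔWord_append_self : lkWord (ΔWord ++ ΔWord) = (589824 : ℤ) • 1 := by
  have h : ∀ i j : Fin 10, entry (lkTable 0 (ΔWord ++ ΔWord)) i j =
      589824 * entry (lkTable 0 []) i j := by decide +kernel
  ext i j
  have h := h i j
  rw [← lkWord_apply, ← lkWord_apply] at h
  rw [h]
  simp [lkWord]

theorem dvd_trace_mul {a b : ℤ} {A B : Matrix (Fin 10) (Fin 10) ℤ} (hA : ∀ i j, a ∣ A i j)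
    (hB : ∀ i j, b ∣ B i j) : a * b ∣ (A * B).trace :=
  Finset.dvd_sum fun i _ => by
    rw [Matrix.diag_apply, Matrix.mul_apply]
    exact Finset.dvd_sum fun j _ => mul_dvd_mul (hA i j) (hB j i)

theorem lkWord_append_modEq {n : ℤ} {u v w m : List (Fin 4)}
    (hu : lkTable n (u ++ w ++ v) = lkTable n w)
    (hm : ∀ i j, lkWord m i j ≡ lkWord w i j [ZMOD n]) (i j : Fin 10) :
    lkWord (u ++ m ++ v) i j ≡ lkWord w i j [ZMOD n] := by
  refine Int.ModEq.trans ?_ (lkWord_modEq_of_lkTable_eq hu i j)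
  simp only [lkWord_append, Matrix.mul_apply]
  exact Int.ModEq.sum fun k _ =>
    Int.ModEq.mul_right _ (Int.ModEq.sum fun k' _ => (hm _ _).mul_left _)

theorem exists_braidWord_T (j : ℕ) : ∃ l, T (j + 2) = braidWord l ∧
    ∀ i j, lkWord l i j ≡ lkWord T2Word i j [ZMOD 8] := by
  induction j with
  | zero => exact ⟨T2Word, braidWord_T2Word.symm, fun _ _ => Int.ModEq.refl _⟩
  | succ j ih =>
    obtain ⟨l, hl, hl'⟩ := ih
    refine ⟨[1, 0, 1, 0, 1, 0, 3, 3] ++ l ++ [3, 3], ?_,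
      lkWord_append_modEq (by decide +kernel) hl'⟩
    rw [T_succ, show j + 1 + 1 = j + 2 from rfl, hl]
    simp [δ3, s1, s2, s4, pow_succ, mul_assoc]

/-- The complement of `Tki 2 i` in `Δ⁷` as a list of indices, for `i = (1, 2)`. -/
def Q2Word : List (Fin 4) :=
    [0, 2, 1, 3, 2, 2, 3, 1, 2, 0, 1, 2, 3, 1, 0, 3, 2, 1, 1, 2, 0, 1, 3, 2,
    1, 2, 3, 1, 2, 0, 1, 1, 0, 2, 1, 3, 2, 1, 1, 2, 3, 0, 1, 2, 0, 1]

theorem exists_braidWord_Qki (j : ℕ) : ∃ l, Qki (j + 2) (Fin.ofNat 2) = braidWord l ∧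
    ∀ i j, lkWord l i j ≡ lkWord Q2Word i j [ZMOD 3] := by
  induction j with
  | zero =>
    refine ⟨Q2Word, ?_, fun _ _ => Int.ModEq.refl _⟩
    have h : reversesToOne (T2Word ++ [0, 0, 1] ++ Q2Word)
        ([0, 0, 1] ++ (List.replicate 7 ΔWord).flatten) = true := by decide +kernel
    have h := braidWord_eq_of_reversesToOne h
    have hw : letterPair 0 (Fin.ofNat 2 0) (Fin.ofNat 2 1) = braidWord [0, 0, 1] := by
      simp [letterPair, aGen, s1, s2]
    simp only [braidWord_append, braidWord_T2Word, List.replicate, List.flatten_cons,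
      List.flatten_nil, braidWord_ΔWord, braidWord_nil, mul_one] at h
    rw [Qki, Tki_two, hw, inv_mul_eq_iff_eq_mul, mul_assoc, mul_assoc, eq_inv_mul_iff_mul_eq]
    simpa [pow_succ, mul_assoc] using h.symm
  | succ j ih =>
    obtain ⟨l, hl, hl'⟩ := ih
    refine ⟨[0, 2, 1, 3, 2, 0, 1, 1, 2, 3, 0, 1, 2, 0] ++ l ++
      [1, 0, 2, 1, 3, 2, 0, 1, 1, 2, 3, 0, 1, 2, 0, 1], ?_,
      lkWord_append_modEq (by decide +kernel) hl'⟩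
    have h₀ : Fin.ofNat 2 (2 * j + 1) = 1 := by ext; simp [Fin.ofNat]
    have h₁ : Fin.ofNat 2 (2 * j + 2) = 0 := by ext; simp [Fin.ofNat]
    have h₂ : Fin.ofNat 2 (2 * j + 3) = 1 := by ext; simp [Fin.ofNat]
    have hX : reversesToOne ([3, 3] ++ [1, 0, 0, 1] ++
        [0, 2, 1, 3, 2, 0, 1, 1, 2, 3, 0, 1, 2, 0]) (ΔWord ++ ΔWord) = true := by decide +kernel
    have hY : reversesToOne ([1, 0, 1, 0, 1, 0, 3, 3] ++ ΔWord ++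
        [1, 0, 2, 1, 3, 2, 0, 1, 1, 2, 3, 0, 1, 2, 0, 1])
        ([1, 0, 0, 1] ++ ΔWord ++ ΔWord ++ ΔWord) = true := by decide +kernel
    have hX := braidWord_eq_of_reversesToOne hX
    have hY := braidWord_eq_of_reversesToOne hY
    rw [Qki_succ _ (j + 1) 1 0 1 (by rw [← h₀, ← h₁]; exact letter_succ _ _)
      (by rw [← h₁, ← h₂]; exact letter_succ _ _), show j + 1 + 1 = j + 2 from rfl, hl,
      braidWord_append, braidWord_append]
    congr 1
    · congr 1
      rw [inv_mul_eq_iff_eq_mul, pow_two, ← braidWord_ΔWord, ← braidWord_append, ← hX]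
      simp [letterPair, aGen, s1, s2, s4, pow_succ, mul_assoc]
    · rw [inv_mul_eq_iff_eq_mul]
      simpa [letterPair, aGen, braidWord_ΔWord, δ3, s1, s2, s4, pow_succ, mul_assoc]
        using hY.symm

theorem isConj_T_Tki (k : ℕ) (i : ℕ → Fin 2) : IsConj (T k) (Tki k i) :=
  isConj_iff.2 ⟨(seqWord i (2 * k - 2))⁻¹, by rw [inv_inv, Tki]⟩

theorem trace_modEq {n : ℤ} {A B : Matrix (Fin 10) (Fin 10) ℤ} (h : ∀ i j, A i j ≡ B i j [ZMOD n]) :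
    A.trace ≡ B.trace [ZMOD n] :=
  Int.ModEq.sum fun i _ => h i i

theorem trace_lkWord_modEq (n : ℤ) (l : List (Fin 4)) :
    (lkWord l).trace ≡ ∑ i : Fin 10, entry (lkTable n l) i i [ZMOD n] :=
  Int.ModEq.sum fun i _ => lkWord_modEq_entry n l i i

theorem le_zero_of_pre {k : ℕ} (hk : 2 ≤ k) {z : B5} (hz : IsConj (T k) z) {p : ℤ}
    (hp : Pre (Δ ^ p) z) : p ≤ 0 := by
  by_contra! hp0
  obtain ⟨n, rfl⟩ : ∃ n : ℕ, p = n + 1 := ⟨(p - 1).toNat, by omega⟩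
  obtain ⟨j, rfl⟩ : ∃ j, k = j + 2 := ⟨k - 2, by omega⟩
  have hΔ : IsPos Δ := braidWord_ΔWord ▸ isPos_braidWord _
  obtain ⟨l, hl⟩ := ((hΔ.pow n).mul hp).exists_braidWord
  obtain ⟨m, hm, hm'⟩ := exists_braidWord_T j
  have e : z = braidWord (ΔWord ++ l) := by
    rw [braidWord_append, braidWord_ΔWord, ← hl, ← mul_assoc, ← pow_succ', ← zpow_natCast,
      Nat.cast_succ, mul_inv_cancel_left]
  have h := lkChar_eq_of_isConj hz
  rw [e, hm, lkChar_braidWord, lkChar_braidWord, Int.cast_inj] at h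
  have h₁ : (24 : ℤ) * 1 ∣ (lkWord (ΔWord ++ l)).trace :=
    lkWord_append ΔWord l ▸ dvd_trace_mul dvd_lkWord_ΔWord fun _ _ => one_dvd _
  have h₂ := (trace_modEq hm').trans (trace_lkWord_modEq 8 T2Word)
  have h₃ : (∑ i : Fin 10, entry (lkTable 8 T2Word) i i) % 8 ≠ 0 := by decide +kernel
  rw [Int.ModEq] at h₂
  omega

theorem le_of_pre_Δ_zpow {k : ℕ} (hk : 2 ≤ k) {z : B5} (hz : IsConj (T k) z) {q : ℤ}
    (hq : Pre z (Δ ^ q)) : 4 * (k : ℤ) - 1 ≤ q := by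
  by_contra! hq0
  obtain ⟨n, hn⟩ : ∃ n : ℕ, 4 * (k : ℤ) = q + n + 2 := ⟨(4 * k - q - 2).toNat, by omega⟩
  have hΔ : IsPos Δ := braidWord_ΔWord ▸ isPos_braidWord _
  obtain ⟨l, hl⟩ := (hq.mul (hΔ.pow n)).exists_braidWord
  obtain ⟨m, hm, hm'⟩ : ∃ m, Qki k (Fin.ofNat 2) = braidWord m ∧
      ∀ i j, lkWord m i j ≡ lkWord Q2Word i j [ZMOD 3] := by
    obtain ⟨j, rfl⟩ : ∃ j, k = j + 2 := ⟨k - 2, by omega⟩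
    exact exists_braidWord_Qki j
  have e₁ : z⁻¹ * Δ ^ (4 * k) = braidWord (l ++ (ΔWord ++ ΔWord)) := by
    rw [braidWord_append, braidWord_append, braidWord_ΔWord, ← hl, ← pow_two, mul_assoc, mul_assoc,
      ← zpow_natCast, ← zpow_natCast, ← zpow_natCast, ← zpow_add, ← zpow_add]
    congr 2
    push_cast
    omega
  have e₂ : (Tki k (Fin.ofNat 2))⁻¹ * Δ ^ (4 * k) = braidWord (m ++ ΔWord) := by
    rw [braidWord_append, ← hm, braidWord_ΔWord, Qki, mul_assoc, ← pow_succ,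
      Nat.sub_add_cancel (by omega)]
  have hc : IsConj (z⁻¹ * Δ ^ (4 * k)) ((Tki k (Fin.ofNat 2))⁻¹ * Δ ^ (4 * k)) := by
    obtain ⟨c, hc⟩ := isConj_iff.1 (hz.symm.trans (isConj_T_Tki k (Fin.ofNat 2)))
    have h : Commute (Δ ^ (4 * k)) c⁻¹ := by
      rw [show 4 * k = 2 * (2 * k) by ring, pow_mul]
      exact (commute_Δ_sq _).pow_left _
    refine isConj_iff.2 ⟨c, ?_⟩
    rw [← hc, mul_assoc, mul_assoc, h.eq]
    simp only [mul_inv_rev, inv_inv, mul_assoc]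
  have h := lkChar_eq_of_isConj hc
  rw [e₁, e₂, lkChar_braidWord, lkChar_braidWord, Int.cast_inj, lkWord_append,
    lkWord_ΔWord_append_self, mul_smul_comm, mul_one, Matrix.trace_smul, smul_eq_mul] at h
  have h₁ : (3 : ℤ) * 24 ∣ ((lkWord Q2Word - lkWord m) * lkWord ΔWord).trace :=
    dvd_trace_mul (fun i j => (hm' i j).dvd) dvd_lkWord_ΔWord
  rw [sub_mul, Matrix.trace_sub, ← lkWord_append, ← lkWord_append] at h₁
  have h₂ := trace_lkWord_modEq 72 (Q2Word ++ ΔWord)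
  have h₃ : (∑ i : Fin 10, entry (lkTable 72 (Q2Word ++ ΔWord)) i i) % 72 ≠ 0 := by
    decide +kernel
  rw [Int.ModEq] at h₂
  omega

theorem exists_pre_Δ_zpow (z : B5) : ∃ p q : ℤ, p ≤ q ∧ Pre (Δ ^ p) z ∧ Pre z (Δ ^ q) := by
  obtain ⟨m, hm⟩ := exists_isPos_Δ_pow_mul z
  obtain ⟨n, hn⟩ := exists_isPos_Δ_pow_mul z⁻¹
  refine ⟨-(2 * m : ℕ), (2 * n : ℕ), by omega, ?_, ?_⟩
  · rwa [Pre, zpow_neg, inv_inv, zpow_natCast, pow_mul]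
  · rwa [Pre, zpow_natCast, pow_mul, ← ((commute_Δ_sq z⁻¹).pow_left n).eq]

theorem le_canLen {k : ℕ} (hk : 2 ≤ k) {z : B5} (hz : IsConj (T k) z) : 4 * k - 1 ≤ canLen z := by
  obtain ⟨p, q, hpq, hp, hq⟩ := exists_pre_Δ_zpow z
  refine le_csInf ⟨(q - p).toNat, p, q, hpq, by omega, hp, hq⟩ ?_
  rintro n ⟨p, q, -, hn, hp, hq⟩
  have h₁ := le_zero_of_pre hk hz hp
  have h₂ := le_of_pre_Δ_zpow hk hz hq
  omega

/-- each `T_{k,i₁,…,i_{2k-2}}` is positive and a prefix of `Δ^{4k-1}`;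
in particular its canonical length is `4k-1` and it belongs to the super summit
set of `T_k`. -/
theorem Tki_in_SSS (k : ℕ) (hk : 2 ≤ k) (i : ℕ → Fin 2) :
    IsPos (Tki k i) ∧ Pre (Tki k i) (Δ ^ (4*k-1)) ∧
    canLen (Tki k i) = 4*k - 1 ∧ InSSS (T k) (Tki k i) := by
  obtain ⟨hT, hQ⟩ := isPos_Tki_and_Qki k hk i
  have hc := isConj_T_Tki k i
  have hle : canLen (Tki k i) ≤ 4 * k - 1 :=
    Nat.sInf_le ⟨0, (4 * k - 1 : ℕ), by omega, by omega, by simpa [Pre] using hT,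
      by rw [zpow_natCast]; exact hQ⟩
  exact ⟨hT, hQ, hle.antisymm (le_canLen hk hc), hc, fun z hz => hle.trans (le_canLen hk hz)⟩
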